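/- arXiv:1707.06389 — 2 statements merged into one kernel-verified Lean document; each statement's English description precedes it below -/
import Mathlib

section
/- (Theorem 1, even case, stated via apolarity) Assume char K = 0 and K algebraically closed. Suppose d = d_1+⋯+d_s = 2k+2 for some k ∈ ℕ. Then for every nonzero multihomogeneous polynomial f ∈ R_𝐝, there exists a saturated homogeneous ideal I of S contained in the apolar ideal (u(f))^⊥, such that dim_K (S/I)_t is a constant c for all sufficiently large t, with c ≤ C(n+k, k) + C(n+k+1, k+1). Consequently the cactus rank of u(f) with respect to the degree-d Veronese embedding of P^n is at most C(n+k, k) + C(n+k+1, k+1). -/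
open MvPolynomial

/-- Variables of `R`: `x_{i,j}` for `j : Fin s`, `i : Fin (n j + 1)` (index `0` is `x_{0,j}`). -/
abbrev RVar (s : ℕ) (n : Fin s → ℕ) := Σ j : Fin s, Fin (n j + 1)

/-- Variables of `S`: `none` is `z_0`, `some ⟨j,i⟩` is `z_{i+1,j}`. -/
abbrev SVar (s : ℕ) (n : Fin s → ℕ) := Option (Σ j : Fin s, Fin (n j))

/-- `f` is multihomogeneous of multidegree `d`. -/
def MultiHomog {K : Type*} [CommSemiring K] {s : ℕ} {n : Fin s → ℕ} (d : Fin s → ℕ)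
    (f : MvPolynomial (RVar s n) K) : Prop :=
  ∀ m ∈ f.support, ∀ j : Fin s, ∑ i : Fin (n j + 1), m ⟨j, i⟩ = d j

/-- The substitution `u : R → S`, `x_{0,j} ↦ z_0`, `x_{i,j} ↦ z_{i,j}` for `i ≥ 1`. -/
noncomputable def subst (K : Type*) [CommSemiring K] (s : ℕ) (n : Fin s → ℕ) :
    MvPolynomial (RVar s n) K →ₐ[K] MvPolynomial (SVar s n) K :=
  aeval fun v => if h : (v.2 : ℕ) = 0 then X none
    else X (some ⟨v.1, ⟨(v.2 : ℕ) - 1, by have := v.2.isLt; omega⟩⟩)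


/-- The action of `g` as a constant-coefficient differential operator on `p`: the
polynomial `g(∂) p`, defined bilinearly from the rule
`∂^μ z^ν = (∏ᵢ νᵢ(νᵢ-1)⋯(νᵢ-μᵢ+1)) z^(ν-μ)` (and `= 0` unless `μ ≤ ν`).
Thus `g` belongs to the apolar ideal `p^⊥` iff `diffOp g p = 0`. -/
noncomputable def diffOp {K : Type*} [CommSemiring K] {σ : Type*} [DecidableEq σ]
    (g p : MvPolynomial σ K) : MvPolynomial σ K :=
  ∑ μ ∈ g.support, ∑ ν ∈ p.support,
    if μ ≤ ν then
      monomial (ν - μ)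
        (coeff μ g * coeff ν p *
          ((∏ i ∈ μ.support, (ν i).descFactorial (μ i) : ℕ) : K))
    else 0

/-- An ideal of `MvPolynomial σ K` is homogeneous (w.r.t. total degree):
it contains all homogeneous components of its elements. -/
def IsHomogIdeal {K : Type*} [CommSemiring K] {σ : Type*}
    (I : Ideal (MvPolynomial σ K)) : Prop :=
  ∀ f ∈ I, ∀ k : ℕ, homogeneousComponent k f ∈ I

/-- An ideal of `MvPolynomial σ K` is saturated with respect to the irrelevant
maximal ideal `(X v : v)`. -/
def IsSatIdeal {K : Type*} [CommSemiring K] {σ : Type*}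
    (I : Ideal (MvPolynomial σ K)) : Prop :=
  ∀ f : MvPolynomial σ K, (∀ v : σ, X v * f ∈ I) → f ∈ I

/-- `dim_K (S/I)_t`, the dimension of the degree-`t` homogeneous component of `S/I`,
computed as `dim (S_t / (I ∩ S_t))`. -/
noncomputable def quotDim (K : Type*) [Field K] {σ : Type*}
    (I : Ideal (MvPolynomial σ K)) (t : ℕ) : ℕ :=
  Module.finrank K
    (↥(homogeneousSubmodule σ K t) ⧸
      Submodule.comap (homogeneousSubmodule σ K t).subtype (Submodule.restrictScalars K I))

namespace Cactus

noncomputable section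

variable {K : Type*} [Field K] {τ : Type*}

/-- `z_0 ↦ T`, `z_i ↦ y_i T`. -/
def Phi (K : Type*) [Field K] (τ : Type*) :
    MvPolynomial (Option τ) K →ₐ[K] Polynomial (MvPolynomial τ K) :=
  aeval fun o => o.elim Polynomial.X (fun i => Polynomial.C (X i) * Polynomial.X)

lemma Phi_monomial (ν : Option τ →₀ ℕ) (c : K) :
    Phi K τ (monomial ν c) = Polynomial.monomial ν.degree (monomial ν.some c) := by
  have h1 : ∀ ν : Option τ →₀ ℕ,
      Phi K τ (monomial ν 1) = Polynomial.monomial ν.degree (monomial ν.some 1) := by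
    intro ν
    induction ν using Finsupp.induction_linear with
    | zero =>
      simp only [map_zero, Finsupp.some_zero, Polynomial.monomial_zero_left]
      erw [map_one, map_one]
    | add a b ha hb =>
      have e1 : (monomial (a + b) (1 : K)) = monomial a 1 * monomial b 1 := by
        simp [monomial_mul]
      rw [e1, map_mul, ha, hb, Polynomial.monomial_mul_monomial, monomial_mul]
      simp
    | single o m =>
      have e1 : (monomial (Finsupp.single o m) (1 : K)) = X o ^ m := by
        rw [X_pow_eq_monomial]
      rw [e1, map_pow, Finsupp.degree_single]
      cases o with
      | none =>
        simp only [Phi, aeval_X, Option.elim, Finsupp.some_single_none]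
        rw [Polynomial.X_pow_eq_monomial]; rfl
      | some i =>
        simp only [Phi, aeval_X, Option.elim, Finsupp.some_single_some]
        rw [mul_pow, ← Polynomial.C_pow, X_pow_eq_monomial, Polynomial.C_mul_X_pow_eq_monomial]
  have h2 : monomial ν c = c • monomial ν (1 : K) := by simp [smul_monomial]
  have h3 : monomial ν.some c = c • monomial ν.some (1 : K) := by simp [smul_monomial]
  rw [h2, h3, map_smul, h1, Polynomial.smul_monomial]

/-- coefficients of `Phi` of homogeneous components -/
lemma Phi_homog (g : MvPolynomial (Option τ) K) (e e' : ℕ) :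
    (Phi K τ (homogeneousComponent e g)).coeff e' =
      if e' = e then (Phi K τ g).coeff e else 0 := by
  induction g using MvPolynomial.induction_on' with
  | monomial ν c =>
    have : homogeneousComponent e (monomial ν c) = if ν.degree = e then monomial ν c else 0 := by
      have hm : (monomial ν c) ∈ homogeneousSubmodule (Option τ) K ν.degree :=
        isHomogeneous_monomial c rfl
      rw [homogeneousComponent_of_mem hm]
      simp [eq_comm]
    rw [this]
    split_ifs with h1 h2 h2
    · subst h2; rfl
    · rw [Phi_monomial, Polynomial.coeff_monomial, if_neg (by omega)]
    · rw [Phi_monomial, Polynomial.coeff_monomial, if_neg (by omega)]; simp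
    · simp
  | add p q hp hq =>
    rw [map_add, map_add, map_add, Polynomial.coeff_add, Polynomial.coeff_add, hp, hq]
    split_ifs <;> simp

/-- product of factorials -/
def fac (ν : Option τ →₀ ℕ) : ℕ := ν.prod fun _ a => a.factorial

/-- the contraction functional `z^ν ↦ ν! coeff_ν p` -/
def ell (p : MvPolynomial (Option τ) K) : MvPolynomial (Option τ) K →ₗ[K] K :=
  (basisMonomials (Option τ) K).constr K fun ν => (fac ν : K) * coeff ν p

lemma ell_monomial (p : MvPolynomial (Option τ) K) (ν : Option τ →₀ ℕ) (c : K) :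
    ell p (monomial ν c) = c * ((fac ν : K) * coeff ν p) := by
  have h2 : monomial ν c = c • (basisMonomials (Option τ) K) ν := by simp [smul_monomial]
  rw [h2, map_smul, ell, Module.Basis.constr_basis, smul_eq_mul]

/-- the dehomogenized functional -/
def Lf (p : MvPolynomial (Option τ) K) (d : ℕ) : MvPolynomial τ K →ₗ[K] K :=
  (basisMonomials τ K).constr K fun m =>
    if m.degree ≤ d then
      (fac (m.optionElim (d - m.degree)) : K) * coeff (m.optionElim (d - m.degree)) p else 0

lemma Lf_monomial (p : MvPolynomial (Option τ) K) (d : ℕ) (m : τ →₀ ℕ) (c : K) :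
    Lf p d (monomial m c) = c * (if m.degree ≤ d then
      (fac (m.optionElim (d - m.degree)) : K) * coeff (m.optionElim (d - m.degree)) p else 0) := by
  have h2 : monomial m c = c • (basisMonomials τ K) m := by simp [smul_monomial]
  rw [h2, map_smul, Lf, Module.Basis.constr_basis, smul_eq_mul]

lemma degree_option (ν : Option τ →₀ ℕ) : ν.degree = ν none + ν.some.degree := by
  induction ν using Finsupp.induction_linear with
  | zero => simp
  | add a b ha hb => simp only [map_add, Finsupp.some_add, Finsupp.add_apply, ha, hb]; omega
  | single o m => cases o <;> simp

lemma ell_eq (p : MvPolynomial (Option τ) K) (d : ℕ) (hp : p.IsHomogeneous d)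
    (g : MvPolynomial (Option τ) K) : ell p g = Lf p d ((Phi K τ g).coeff d) := by
  induction g using MvPolynomial.induction_on' with
  | monomial ν c =>
    rw [ell_monomial, Phi_monomial, Polynomial.coeff_monomial]
    split_ifs with h
    · have h1 := degree_option ν
      rw [Lf_monomial, if_pos (by omega)]
      have : ν.some.optionElim (d - ν.some.degree) = ν := by
        rw [show d - ν.some.degree = ν none by omega, Finsupp.optionElim_some]
      rw [this]
    · rw [hp.coeff_eq_zero h]; simp
  | add a b ha hb => simp [ha, hb]

/-- The affine annihilator of a functional. -/
def annI (L : MvPolynomial τ K →ₗ[K] K) : Ideal (MvPolynomial τ K) where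
  carrier := {g | ∀ h, L (g * h) = 0}
  add_mem' := by
    intro a b ha hb h
    rw [add_mul, map_add, ha h, hb h, add_zero]
  zero_mem' := by intro h; simp
  smul_mem' := by
    intro c x hx h
    have := hx (c * h)
    rwa [← mul_assoc, mul_comm x c] at this

/-- The exponent on `τ` coded by a multiset of size `k` on `Option τ`. -/
def expo [DecidableEq τ] {k : ℕ} (q : Sym (Option τ) k) : τ →₀ ℕ :=
  (Multiset.toFinsupp (q : Multiset (Option τ))).some

lemma exists_expo [DecidableEq τ] {k : ℕ} (m : τ →₀ ℕ) (h : m.degree ≤ k) :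
    ∃ q : Sym (Option τ) k, expo q = m := by
  refine ⟨⟨Finsupp.toMultiset (m.optionElim (k - m.degree)), ?_⟩, ?_⟩
  · have := degree_option (m.optionElim (k - m.degree))
    rw [Finsupp.some_optionElim, Finsupp.optionElim_apply_none] at this
    rw [Finsupp.card_toMultiset]
    change (m.optionElim (k - m.degree)).degree = k
    omega
  · simp [expo]

section Dim

variable [Fintype τ] [DecidableEq τ]

def Theta (L : MvPolynomial τ K →ₗ[K] K) (k : ℕ) :
    MvPolynomial τ K →ₗ[K] ((Sym (Option τ) (k+1) → K) × (Sym (Option τ) k → K)) :=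
  LinearMap.prod (LinearMap.pi fun q => MvPolynomial.lcoeff K (expo q))
    (LinearMap.pi fun q => L ∘ₗ LinearMap.mulRight K (monomial (expo q) 1))

lemma ker_Theta (L : MvPolynomial τ K →ₗ[K] K) (k : ℕ)
    (hL : ∀ m : τ →₀ ℕ, 2 * k + 2 < m.degree → ∀ c, L (monomial m c) = 0) :
    LinearMap.ker (Theta L k) ≤ (annI L).restrictScalars K := by
  intro g hg
  have hg1 : Theta L k g = 0 := hg
  have h1 : ∀ m : τ →₀ ℕ, m.degree ≤ k + 1 → coeff m g = 0 := by
    intro m hm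
    obtain ⟨q, rfl⟩ := exists_expo m hm
    exact congrFun (congrArg Prod.fst hg1) q
  have h2 : ∀ m : τ →₀ ℕ, m.degree ≤ k → L (g * monomial m 1) = 0 := by
    intro m hm
    obtain ⟨q, rfl⟩ := exists_expo m hm
    exact congrFun (congrArg Prod.snd hg1) q
  change ∀ h, L (g * h) = 0
  intro h
  induction h using MvPolynomial.induction_on' with
  | add a b ha hb => rw [mul_add, map_add, ha, hb, add_zero]
  | monomial m c =>
    have hc : monomial m c = c • monomial m (1 : K) := by simp [smul_monomial]
    by_cases hm : m.degree ≤ k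
    · rw [hc, mul_smul_comm, map_smul, h2 m hm, smul_zero]
    · rw [g.as_sum, Finset.sum_mul, map_sum]
      refine Finset.sum_eq_zero fun v hv => ?_
      rw [monomial_mul]
      apply hL
      have : ¬ v.degree ≤ k + 1 := fun hh => (mem_support_iff.mp hv) (h1 v hh)
      rw [map_add]; omega

lemma finrank_le (L : MvPolynomial τ K →ₗ[K] K) (k : ℕ)
    (hL : ∀ m : τ →₀ ℕ, 2 * k + 2 < m.degree → ∀ c, L (monomial m c) = 0) :
    Module.finrank K (MvPolynomial τ K ⧸ annI L) ≤
      Nat.choose (Fintype.card τ + k) k + Nat.choose (Fintype.card τ + k + 1) (k + 1) := by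
  have hk := ker_Theta L k hL
  let e := (Theta L k).quotKerEquivRange
  have hf : Module.Finite K (MvPolynomial τ K ⧸ LinearMap.ker (Theta L k)) :=
    Module.Finite.equiv e.symm
  have h1 : Module.finrank K (MvPolynomial τ K ⧸ LinearMap.ker (Theta L k)) ≤
      Nat.choose (Fintype.card τ + k) k + Nat.choose (Fintype.card τ + k + 1) (k + 1) := by
    rw [e.finrank_eq]
    refine (Submodule.finrank_le _).trans ?_
    rw [Module.finrank_prod, Module.finrank_pi, Module.finrank_pi, Sym.card_sym_eq_choose,
      Sym.card_sym_eq_choose, Fintype.card_option]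
    rw [show Fintype.card τ + 1 + (k + 1) - 1 = Fintype.card τ + k + 1 by omega,
      show Fintype.card τ + 1 + k - 1 = Fintype.card τ + k by omega, add_comm]
  refine le_trans ?_ h1
  let π : (MvPolynomial τ K ⧸ LinearMap.ker (Theta L k)) →ₗ[K] (MvPolynomial τ K ⧸ annI L) :=
    (LinearMap.ker (Theta L k)).liftQ ((Ideal.Quotient.mkₐ K (annI L)).toLinearMap) (by
      intro x hx
      exact Ideal.Quotient.eq_zero_iff_mem.mpr (hk hx))
  refine LinearMap.finrank_le_finrank_of_surjective (f := π) ?_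
  intro b
  obtain ⟨g, rfl⟩ := Ideal.Quotient.mk_surjective b
  exact ⟨Submodule.Quotient.mk g, rfl⟩

end Dim

/-- The final map. -/
def Psi (J : Ideal (MvPolynomial τ K)) :
    MvPolynomial (Option τ) K →+* Polynomial (MvPolynomial τ K ⧸ J) :=
  (Polynomial.mapRingHom (Ideal.Quotient.mk J)).comp (Phi K τ).toRingHom

lemma Psi_coeff (J : Ideal (MvPolynomial τ K)) (g : MvPolynomial (Option τ) K) (e : ℕ) :
    (Psi J g).coeff e = Ideal.Quotient.mk J ((Phi K τ g).coeff e) := by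
  simp [Psi]

lemma mem_ker_Psi (J : Ideal (MvPolynomial τ K)) (g : MvPolynomial (Option τ) K) :
    g ∈ RingHom.ker (Psi J) ↔ ∀ e, (Phi K τ g).coeff e ∈ J := by
  rw [RingHom.mem_ker, Polynomial.ext_iff]
  simp only [Psi_coeff, Polynomial.coeff_zero, Ideal.Quotient.eq_zero_iff_mem]

lemma homog_ker (J : Ideal (MvPolynomial τ K)) : IsHomogIdeal (RingHom.ker (Psi J)) := by
  intro g hg e
  rw [mem_ker_Psi] at hg ⊢
  intro e'
  rw [Phi_homog]
  split_ifs
  · exact hg e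
  · exact J.zero_mem

lemma sat_ker (J : Ideal (MvPolynomial τ K)) : IsSatIdeal (RingHom.ker (Psi J)) := by
  intro g hg
  rw [mem_ker_Psi]
  intro e
  have := (mem_ker_Psi J _).1 (hg none) (e + 1)
  rwa [map_mul, show Phi K τ (X none) = Polynomial.X by simp [Phi],
    Polynomial.coeff_X_mul] at this

lemma quotDim_ker (J : Ideal (MvPolynomial τ K)) (t d : ℕ) (htd : d ≤ t)
    (hJ : ∀ m : τ →₀ ℕ, d < m.degree → ∀ c, monomial m c ∈ J) :
    quotDim K (RingHom.ker (Psi J)) t = Module.finrank K (MvPolynomial τ K ⧸ J) := by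
  let ψ : ↥(homogeneousSubmodule (Option τ) K t) →ₗ[K] (MvPolynomial τ K ⧸ J) :=
    (Ideal.Quotient.mkₐ K J).toLinearMap ∘ₗ
      ((Polynomial.lcoeff (MvPolynomial τ K) t).restrictScalars K) ∘ₗ
      (Phi K τ).toLinearMap ∘ₗ (homogeneousSubmodule (Option τ) K t).subtype
  have hψ : ∀ x, ψ x = Ideal.Quotient.mk J ((Phi K τ (x : MvPolynomial (Option τ) K)).coeff t) :=
    fun x => rfl
  have hker : Submodule.comap (homogeneousSubmodule (Option τ) K t).subtype
      (Submodule.restrictScalars K (RingHom.ker (Psi J))) = LinearMap.ker ψ := by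
    ext x
    rw [LinearMap.mem_ker, hψ, Ideal.Quotient.eq_zero_iff_mem]
    change (x : MvPolynomial (Option τ) K) ∈ RingHom.ker (Psi J) ↔ _
    rw [mem_ker_Psi]
    refine ⟨fun h => h t, fun h e => ?_⟩
    have hx : homogeneousComponent t (x : MvPolynomial (Option τ) K) = x :=
      homogeneousComponent_eq_self x.2
    rw [← hx, Phi_homog]
    split_ifs
    · exact h
    · exact J.zero_mem
  have hsurj : Function.Surjective ψ := by
    rw [← LinearMap.range_eq_top, eq_top_iff]
    intro b _
    obtain ⟨g, rfl⟩ := Ideal.Quotient.mk_surjective b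
    induction g using MvPolynomial.induction_on' with
    | add a b ha hb => rw [map_add]; exact Submodule.add_mem _ (ha trivial) (hb trivial)
    | monomial m c =>
      by_cases hm : d < m.degree
      · rw [Ideal.Quotient.eq_zero_iff_mem.mpr (hJ m hm c)]
        exact Submodule.zero_mem _
      · have hdeg : (m.optionElim (t - m.degree)).degree = t := by
          rw [degree_option, Finsupp.some_optionElim, Finsupp.optionElim_apply_none]
          omega
        refine ⟨⟨monomial (m.optionElim (t - m.degree)) c, isHomogeneous_monomial c hdeg⟩, ?_⟩
        rw [hψ, Phi_monomial, Polynomial.coeff_monomial, if_pos hdeg, Finsupp.some_optionElim]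
  rw [quotDim, hker]
  exact (ψ.quotKerEquivOfSurjective hsurj).finrank_eq

lemma fac_add (μ ν : Option τ →₀ ℕ) [DecidableEq τ] (h : μ ≤ ν) :
    fac (ν - μ) * ∏ i ∈ μ.support, (ν i).descFactorial (μ i) = fac ν := by
  have h1 : fac (ν - μ) = ∏ i ∈ ν.support, ((ν - μ) i).factorial :=
    Finsupp.prod_of_support_subset _ Finsupp.support_tsub _ (by simp)
  have h2 : ∏ i ∈ μ.support, (ν i).descFactorial (μ i) =
      ∏ i ∈ ν.support, (ν i).descFactorial (μ i) := by
    refine Finset.prod_subset (Finsupp.support_mono h) ?_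
    intro i _ hi
    rw [Finsupp.notMem_support_iff.mp hi, Nat.descFactorial_zero]
  rw [h1, h2, ← Finset.prod_mul_distrib, fac, Finsupp.prod]
  refine Finset.prod_congr rfl fun i _ => ?_
  rw [Finsupp.tsub_apply]
  exact Nat.factorial_mul_descFactorial (h i)

lemma fac_ne [CharZero K] (ν : Option τ →₀ ℕ) : (fac ν : K) ≠ 0 := by
  rw [Nat.cast_ne_zero, fac, Finsupp.prod, Finset.prod_ne_zero_iff]
  exact fun i _ => Nat.factorial_ne_zero _

lemma diffOp_coeff [DecidableEq (Option τ)] [CharZero K] (g p : MvPolynomial (Option τ) K)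
    (l : Option τ →₀ ℕ) :
    (fac l : K) * coeff l (diffOp g p) = ell p (g * monomial l 1) := by
  classical
  conv_rhs => rw [g.as_sum, Finset.sum_mul, map_sum]
  rw [diffOp, coeff_sum, Finset.mul_sum]
  refine Finset.sum_congr rfl fun μ _ => ?_
  rw [monomial_mul, ell_monomial, coeff_sum, mul_one]
  rw [Finset.sum_eq_single (μ + l)]
  · rw [if_pos le_self_add, add_tsub_cancel_left, coeff_monomial, if_pos rfl]
    have := fac_add μ (μ + l) le_self_add
    rw [add_tsub_cancel_left] at this
    rw [← this]
    push_cast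
    ring
  · intro ν _ hne
    split_ifs with h
    · rw [coeff_monomial, if_neg]
      rintro rfl
      exact hne (add_tsub_cancel_of_le h).symm
    · simp
  · intro hns
    rw [notMem_support_iff] at hns
    simp [hns]

theorem main [CharZero K] [Fintype τ] [DecidableEq (Option τ)] (p : MvPolynomial (Option τ) K)
    (k : ℕ) (hp : p.IsHomogeneous (2 * k + 2)) :
    ∃ I : Ideal (MvPolynomial (Option τ) K),
      IsHomogIdeal I ∧ IsSatIdeal I ∧
      (∀ g ∈ I, diffOp g p = 0) ∧
      ∃ c : ℕ,
        c ≤ Nat.choose (Fintype.card τ + k) k + Nat.choose (Fintype.card τ + k + 1) (k + 1) ∧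
        ∃ T : ℕ, ∀ t ≥ T, quotDim K I t = c := by
  classical
  set L := Lf p (2 * k + 2) with hLdef
  have hL : ∀ m : τ →₀ ℕ, 2 * k + 2 < m.degree → ∀ c, L (monomial m c) = 0 := by
    intro m hm c
    rw [hLdef, Lf_monomial, if_neg (by omega), mul_zero]
  refine ⟨RingHom.ker (Psi (annI L)), homog_ker _, sat_ker _, ?_, _, finrank_le L k hL,
    2 * k + 2, fun t ht => quotDim_ker _ t (2 * k + 2) ht ?_⟩
  · intro g hg
    ext l
    rw [coeff_zero]
    have h1 := diffOp_coeff g p l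
    have h2 : g * monomial l 1 ∈ RingHom.ker (Psi (annI L)) := Ideal.mul_mem_right _ _ hg
    have h3 : L ((Phi K τ (g * monomial l 1)).coeff (2 * k + 2) * 1) = 0 :=
      (mem_ker_Psi _ _).1 h2 (2 * k + 2) 1
    rw [ell_eq p _ hp, ← hLdef, ← mul_one (Polynomial.coeff _ _), h3] at h1
    exact (mul_eq_zero.mp h1).resolve_left (fac_ne l)
  · intro m hm c h
    rw [mul_comm, h.as_sum, Finset.sum_mul, map_sum]
    refine Finset.sum_eq_zero fun v _ => ?_
    rw [monomial_mul]
    apply hL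
    rw [map_add]; omega

end

end Cactus

/-- **Theorem 1, even case, via apolarity.** If `d = ∑ dⱼ = 2k + 2`, then for
every nonzero multihomogeneous `f ∈ R_𝐝` there is a saturated homogeneous ideal `I` of `S`
contained in the apolar ideal `(u f)^⊥` such that `dim_K (S/I)_t` is a constant
`c ≤ C(n+k, k) + C(n+k+1, k+1)` for all sufficiently large `t` (where `n = ∑ nⱼ`); hence
the cactus rank of `u f` w.r.t. the degree-`d` Veronese embedding of `ℙⁿ` is at most
`C(n+k, k) + C(n+k+1, k+1)`. -/
theorem stmt8 (K : Type*) [Field K] [IsAlgClosed K] [CharZero K]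
    (s : ℕ) (hs : 0 < s) (n : Fin s → ℕ) (hn : ∀ j, 0 < n j) (d : Fin s → ℕ) (k : ℕ)
    (hd : ∑ j, d j = 2 * k + 2)
    (f : MvPolynomial (RVar s n) K) (hf : MultiHomog d f) (hf0 : f ≠ 0) :
    ∃ I : Ideal (MvPolynomial (SVar s n) K),
      IsHomogIdeal I ∧ IsSatIdeal I ∧
      (∀ g ∈ I, diffOp g (subst K s n f) = 0) ∧
      ∃ c : ℕ,
        c ≤ Nat.choose ((∑ j, n j) + k) k + Nat.choose ((∑ j, n j) + k + 1) (k + 1) ∧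
        ∃ T : ℕ, ∀ t ≥ T, quotDim K I t = c := by
  have hf' : f.IsHomogeneous (2 * k + 2) := by
    intro m hm
    have e : Finsupp.weight (1 : RVar s n → ℕ) m = m.degree :=
      (DFunLike.congr_fun (Finsupp.degree_eq_weight_one (σ := RVar s n) (R := ℕ)) m).symm
    rw [e, ← hd, Finsupp.degree_eq_sum, Fintype.sum_sigma]
    exact Finset.sum_congr rfl fun j _ => hf m (mem_support_iff.mpr hm) j
  have hp : (subst K s n f).IsHomogeneous (2 * k + 2) := by
    have := hf'.aeval (n := 1) (fun v : RVar s n => if h : (v.2 : ℕ) = 0 then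
      (X none : MvPolynomial (SVar s n) K)
      else X (some ⟨v.1, ⟨(v.2 : ℕ) - 1, by have := v.2.isLt; omega⟩⟩)) (by
        intro v
        split_ifs <;> exact isHomogeneous_X _ _)
    rw [one_mul] at this
    exact this
  have h := Cactus.main (subst K s n f) k hp
  rw [Fintype.card_sigma] at h
  simpa only [Fintype.card_fin] using h
end

section
/- (Tensor case, s odd) Assume char K = 0 and K algebraically closed. Let s be odd, let d_1 = ⋯ = d_s = 1 and n_1 = ⋯ = n_s = m, so that d = s and n = ms, and write k = (s−1)/2. Then for every nonzero multilinear polynomial f ∈ R_{(1,…,1)} (i.e. f of degree 1 in each of the s blocks of m+1 variables), there exists a saturated homogeneous ideal I of S contained in the apolar ideal (u(f))^⊥ with dim_K(S/I)_t equal to a constant c ≤ 2·C(m·s + k, k) for all sufficiently large t; hence the cactus rank of u(f) with respect to the degree-s Veronese embedding of P^{ms} is at most 2·C(ms + k, k). -/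
open MvPolynomial

/-- The linear functional on polynomials taking the value `w μ` on the monomial `z^μ`. -/
noncomputable def linFun {K : Type*} [Field K] {τ : Type*} (w : (τ →₀ ℕ) → K) :
    MvPolynomial τ K →ₗ[K] K := (basisMonomials τ K).constr K w

lemma linFun_monomial {K : Type*} [Field K] {τ : Type*} (w : (τ →₀ ℕ) → K) (μ : τ →₀ ℕ) (c : K) :
    linFun w (monomial μ c) = c * w μ := by
  have h : monomial μ c = c • basisMonomials τ K μ := by
    simp [coe_basisMonomials, smul_monomial]
  rw [h, map_smul, linFun, Module.Basis.constr_basis, smul_eq_mul]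

lemma linFun_monomial_mul {K : Type*} [Field K] {τ : Type*} (w : (τ →₀ ℕ) → K) (a : τ →₀ ℕ)
    (p : MvPolynomial τ K) :
    linFun w (monomial a 1 * p) = ∑ b ∈ p.support, coeff b p * w (a + b) := by
  conv_lhs => rw [p.as_sum]
  rw [Finset.mul_sum, map_sum]
  refine Finset.sum_congr rfl fun b _ => ?_
  rw [monomial_mul, linFun_monomial, one_mul]

/-- Weight of the functional attached to `F`. -/
noncomputable def apolW {K : Type*} [Field K] {τ : Type*} [Fintype τ] (F : MvPolynomial τ K)
    (ν : τ →₀ ℕ) : K := coeff ν F * ((∏ i, (ν i).factorial : ℕ) : K)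

lemma diffOp_eq_zero {K : Type*} [Field K] [CharZero K] {τ : Type*} [Fintype τ] [DecidableEq τ]
    (F G : MvPolynomial τ K)
    (h : ∀ l : τ →₀ ℕ, linFun (apolW F) (monomial l 1 * G) = 0) : diffOp G F = 0 := by
  ext l
  have hl : ((∏ i, (l i).factorial : ℕ) : K) ≠ 0 := by
    rw [Nat.cast_ne_zero, Finset.prod_ne_zero_iff]
    exact fun i _ => Nat.factorial_ne_zero _
  apply mul_left_cancel₀ hl
  rw [coeff_zero, mul_zero, ← h l, linFun_monomial_mul, diffOp, coeff_sum, Finset.mul_sum]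
  refine Finset.sum_congr rfl fun μ _ => ?_
  rw [coeff_sum, Finset.sum_eq_single (l + μ)]
  · rw [if_pos le_add_self, add_tsub_cancel_right, coeff_monomial, if_pos rfl, apolW]
    have : (∏ i, (l i).factorial) * (∏ i ∈ μ.support, ((l + μ) i).descFactorial (μ i))
        = ∏ i, ((l + μ) i).factorial := by
      rw [Finset.prod_subset (Finset.subset_univ μ.support), ← Finset.prod_mul_distrib]
      · refine Finset.prod_congr rfl fun i _ => ?_
        rw [← Nat.factorial_mul_descFactorial (n := (l + μ) i) (k := μ i) (by simp)]
        simp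
      · intro i _ hi
        rw [Finsupp.notMem_support_iff.1 hi, Nat.descFactorial_zero]
    rw [← this]
    push_cast
    ring
  · intro ν _ hν
    split_ifs with hle
    · rw [coeff_monomial, if_neg]
      rintro rfl
      exact hν (tsub_add_cancel_of_le hle).symm
    · simp
  · intro hν
    rw [notMem_support_iff.1 hν]
    simp

/-- The annihilator ideal of a functional. -/
def annIdeal {K : Type*} [Field K] {τ : Type*} (L : MvPolynomial τ K →ₗ[K] K) :
    Ideal (MvPolynomial τ K) where
  carrier := {p | ∀ q, L (q * p) = 0}
  add_mem' := by
    intro a b ha hb q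
    rw [mul_add, map_add, ha q, hb q, add_zero]
  zero_mem' := by intro q; simp
  smul_mem' := by
    intro c x hx q
    rw [smul_eq_mul, ← mul_assoc]
    exact hx _

lemma mem_annIdeal_of {K : Type*} [Field K] {τ : Type*} (L : MvPolynomial τ K →ₗ[K] K)
    (p : MvPolynomial τ K) (h : ∀ a, L (monomial a 1 * p) = 0) : p ∈ annIdeal L := by
  intro q
  induction q using MvPolynomial.induction_on' with
  | monomial a c =>
    have : monomial a c = c • monomial a (1 : K) := by simp [smul_monomial]
    rw [this, smul_mul_assoc, map_smul, h a, smul_zero]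
  | add p q hp hq => rw [add_mul, map_add, hp, hq, add_zero]

lemma degree_optionElim {σ : Type*} [Fintype σ] (y : ℕ) (a : σ →₀ ℕ) :
    (a.optionElim y).degree = y + a.degree := by
  rw [Finsupp.degree_eq_sum, Finsupp.degree_eq_sum, Fintype.sum_option]
  simp

lemma degree_some_add {σ : Type*} [Fintype σ] (μ : Option σ →₀ ℕ) :
    μ none + μ.some.degree = μ.degree := by
  rw [← degree_optionElim, Finsupp.optionElim_some]

lemma finrank_ann_le {K : Type*} [Field K] {σ : Type*} [Fintype σ] (k : ℕ)
    (v : (σ →₀ ℕ) → K) (hv : ∀ a, 2 * k + 1 < a.degree → v a = 0) :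
    Module.finrank K (MvPolynomial σ K ⧸ (annIdeal (linFun v)).restrictScalars K) ≤
      2 * Nat.choose (Fintype.card σ + k) k := by
  classical
  let e : Sym (Option σ) k → (σ →₀ ℕ) := fun x => (Sym.equivNatSum (Option σ) k x).1.some
  have he : ∀ a : σ →₀ ℕ, a.degree ≤ k → ∃ x, e x = a := by
    intro a ha
    refine ⟨(Sym.equivNatSum (Option σ) k).symm ⟨a.optionElim (k - a.degree), ?_⟩, ?_⟩
    · have := degree_optionElim (k - a.degree) a
      rw [Finsupp.degree_apply] at this
      simp only [Finsupp.sum, id]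
      omega
    · simp [e]
  let Φ : MvPolynomial σ K →ₗ[K] (Sym (Option σ) k → K) × (Sym (Option σ) k → K) :=
    LinearMap.prod (LinearMap.pi fun x => MvPolynomial.lcoeff K (e x))
      (LinearMap.pi fun x => (linFun v).comp (LinearMap.mulLeft K (monomial (e x) 1)))
  have hker : LinearMap.ker Φ ≤ (annIdeal (linFun v)).restrictScalars K := by
    intro p hp
    rw [LinearMap.mem_ker] at hp
    have h1 : ∀ x, coeff (e x) p = 0 := fun x => congrFun (congrArg Prod.fst hp) x
    have h2 : ∀ x, linFun v (monomial (e x) 1 * p) = 0 :=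
      fun x => congrFun (congrArg Prod.snd hp) x
    rw [Submodule.restrictScalars_mem]
    refine mem_annIdeal_of _ _ fun a => ?_
    by_cases ha : a.degree ≤ k
    · obtain ⟨x, rfl⟩ := he a ha
      exact h2 x
    · rw [linFun_monomial_mul]
      refine Finset.sum_eq_zero fun b hb => ?_
      by_cases hbk : b.degree ≤ k
      · obtain ⟨x, rfl⟩ := he b hbk
        rw [h1, zero_mul]
      · rw [hv, mul_zero]
        rw [map_add]
        omega
  have hs : Function.Surjective (Submodule.factor hker) := Submodule.factor_surjective hker
  have hfin : Module.Finite K (MvPolynomial σ K ⧸ LinearMap.ker Φ) :=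
    Module.Finite.equiv Φ.quotKerEquivRange.symm
  calc _ ≤ Module.finrank K (MvPolynomial σ K ⧸ LinearMap.ker Φ) :=
        LinearMap.finrank_le_finrank_of_surjective hs
    _ = Module.finrank K (LinearMap.range Φ) := Φ.quotKerEquivRange.finrank_eq
    _ ≤ Module.finrank K ((Sym (Option σ) k → K) × (Sym (Option σ) k → K)) :=
        Submodule.finrank_le _
    _ = _ := by
      rw [Module.finrank_prod, Module.finrank_fintype_fun_eq_card, Sym.card_sym_eq_choose,
        Fintype.card_option, two_mul]
      congr 2 <;> omega

/-- Dehomogenization. -/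
noncomputable def dehom (K : Type*) [Field K] (σ : Type*) :
    MvPolynomial (Option σ) K →ₐ[K] MvPolynomial σ K :=
  aeval fun v => v.elim 1 X

/-- Graded dehomogenization. -/
noncomputable def grDehom (K : Type*) [Field K] (σ : Type*) :
    MvPolynomial (Option σ) K →ₐ[K] Polynomial (MvPolynomial σ K) :=
  aeval fun v => v.elim Polynomial.X (fun i => Polynomial.C (X i) * Polynomial.X)

lemma dehom_monomial {K : Type*} [Field K] {σ : Type*} [Fintype σ] (μ : Option σ →₀ ℕ) (c : K) :
    dehom K σ (monomial μ c) = monomial μ.some c := by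
  rw [dehom, aeval_monomial, monomial_eq, Finsupp.prod_fintype _ _ (by simp),
    Finsupp.prod_fintype _ _ (by simp), Fintype.prod_option]
  simp [algebraMap_eq]

lemma grDehom_monomial {K : Type*} [Field K] {σ : Type*} [Fintype σ] (μ : Option σ →₀ ℕ) (c : K) :
    grDehom K σ (monomial μ c) = Polynomial.monomial μ.degree (monomial μ.some c) := by
  rw [grDehom, aeval_monomial, monomial_eq, Finsupp.prod_fintype _ _ (by simp),
    Finsupp.prod_fintype _ _ (by simp), Fintype.prod_option, ← degree_some_add,
    Finsupp.degree_eq_sum, ← Polynomial.C_mul_X_pow_eq_monomial]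
  simp only [Option.elim, mul_pow, Finset.prod_mul_distrib, Finset.prod_pow_eq_pow_sum,
    Polynomial.C_mul, map_prod, Polynomial.C_pow, pow_add, Finsupp.some_apply]
  rw [IsScalarTower.algebraMap_apply K (MvPolynomial σ K) (Polynomial (MvPolynomial σ K)),
    algebraMap_eq, Polynomial.algebraMap_eq]
  ring

lemma homogComp_monomial {K : Type*} [Field K] {τ : Type*} (μ : τ →₀ ℕ) (c : K) (t : ℕ) :
    homogeneousComponent t (monomial μ c) = if t = μ.degree then monomial μ c else 0 :=
  homogeneousComponent_of_mem (isHomogeneous_monomial c rfl)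

lemma coeff_grDehom {K : Type*} [Field K] {σ : Type*} [Fintype σ] (t : ℕ)
    (G : MvPolynomial (Option σ) K) :
    (grDehom K σ G).coeff t = dehom K σ (homogeneousComponent t G) := by
  induction G using MvPolynomial.induction_on' with
  | monomial μ c =>
    rw [grDehom_monomial, homogComp_monomial, Polynomial.coeff_monomial]
    by_cases h : t = μ.degree
    · rw [if_pos h, if_pos h.symm, dehom_monomial]
    · rw [if_neg h, if_neg (Ne.symm h), map_zero]
  | add p q hp hq => rw [map_add, Polynomial.coeff_add, hp, hq, map_add, map_add]

/-- Homogenization of an ideal. -/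
noncomputable def homIdeal {K : Type*} [Field K] {σ : Type*} (J : Ideal (MvPolynomial σ K)) :
    Ideal (MvPolynomial (Option σ) K) :=
  (J.map (Polynomial.C : MvPolynomial σ K →+* _)).comap (grDehom K σ)

lemma mem_homIdeal {K : Type*} [Field K] {σ : Type*} [Fintype σ] {J : Ideal (MvPolynomial σ K)}
    {G : MvPolynomial (Option σ) K} :
    G ∈ homIdeal J ↔ ∀ t, dehom K σ (homogeneousComponent t G) ∈ J := by
  rw [homIdeal, Ideal.mem_comap]
  refine Ideal.mem_map_C_iff.trans ?_
  exact forall_congr' fun t => by rw [← coeff_grDehom]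

lemma mem_homIdeal_of_homog {K : Type*} [Field K] {σ : Type*} [Fintype σ]
    {J : Ideal (MvPolynomial σ K)} {G : MvPolynomial (Option σ) K} {t : ℕ}
    (hG : G.IsHomogeneous t) :
    G ∈ homIdeal J ↔ dehom K σ G ∈ J := by
  rw [mem_homIdeal]
  constructor
  · intro h
    have := h t
    rwa [homogeneousComponent_eq_self hG] at this
  · intro h r
    rw [homogeneousComponent_of_mem hG]
    split_ifs
    · exact h
    · simp

lemma quotDim_homIdeal {K : Type*} [Field K] {σ : Type*} [Fintype σ]
    (J : Ideal (MvPolynomial σ K)) (d : ℕ)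
    (hJ : ∀ a : σ →₀ ℕ, d < a.degree → ∀ c, monomial a c ∈ J) (t : ℕ) (ht : d ≤ t) :
    quotDim K (homIdeal J) t =
      Module.finrank K (MvPolynomial σ K ⧸ J.restrictScalars K) := by
  let Ψ : homogeneousSubmodule (Option σ) K t →ₗ[K]
      (MvPolynomial σ K ⧸ J.restrictScalars K) :=
    (J.restrictScalars K).mkQ ∘ₗ (dehom K σ).toLinearMap ∘ₗ
      (homogeneousSubmodule (Option σ) K t).subtype
  have hker : Submodule.comap (homogeneousSubmodule (Option σ) K t).subtype
      (Submodule.restrictScalars K (homIdeal J)) = LinearMap.ker Ψ := by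
    ext ⟨G, hG⟩
    have := mem_homIdeal_of_homog (J := J) hG
    simpa [Ψ] using this
  have hsurj : Function.Surjective Ψ := by
    rw [← LinearMap.range_eq_top, eq_top_iff]
    intro x _
    obtain ⟨p, rfl⟩ := Submodule.mkQ_surjective _ x
    induction p using MvPolynomial.induction_on' with
    | monomial a c =>
      by_cases ha : a.degree ≤ t
      · refine ⟨⟨monomial (a.optionElim (t - a.degree)) c, ?_⟩, ?_⟩
        · refine isHomogeneous_monomial c ?_
          rw [degree_optionElim]
          omega
        · simp [Ψ, dehom_monomial]
      · have : (J.restrictScalars K).mkQ (monomial a c) = 0 := by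
          rw [Submodule.mkQ_apply, Submodule.Quotient.mk_eq_zero]
          exact hJ a (by omega) c
        rw [this]
        exact Submodule.zero_mem _
    | add p q hp hq =>
      rw [map_add]
      exact Submodule.add_mem _ (hp trivial) (hq trivial)
  rw [quotDim, hker]
  exact (Ψ.quotKerEquivOfSurjective hsurj).finrank_eq

lemma main_general {K : Type*} [Field K] [CharZero K] {σ : Type*} [Fintype σ] [DecidableEq σ]
    (k : ℕ) (F : MvPolynomial (Option σ) K) (hF : F.IsHomogeneous (2 * k + 1)) :
    ∃ I : Ideal (MvPolynomial (Option σ) K),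
      IsHomogIdeal I ∧ IsSatIdeal I ∧ (∀ g ∈ I, diffOp g F = 0) ∧
      ∃ c : ℕ, c ≤ 2 * Nat.choose (Fintype.card σ + k) k ∧
        ∃ T : ℕ, ∀ t ≥ T, quotDim K I t = c := by
  let v : (σ →₀ ℕ) → K := fun a =>
    if a.degree ≤ 2 * k + 1 then apolW F (a.optionElim (2 * k + 1 - a.degree)) else 0
  have hv : ∀ a, 2 * k + 1 < a.degree → v a = 0 := fun a ha => if_neg (by omega)
  have hLl : ∀ G : MvPolynomial (Option σ) K, linFun (apolW F) G =
      linFun v (dehom K σ (homogeneousComponent (2 * k + 1) G)) := by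
    intro G
    induction G using MvPolynomial.induction_on' with
    | monomial μ c =>
      rw [homogComp_monomial, linFun_monomial]
      split_ifs with h
      · have h2 := degree_some_add μ
        rw [dehom_monomial, linFun_monomial]
        simp only [v]
        rw [if_pos (by omega)]
        have : 2 * k + 1 - μ.some.degree = μ none := by omega
        rw [this, Finsupp.optionElim_some]
      · have : coeff μ F = 0 := hF.coeff_eq_zero (Ne.symm h)
        simp [apolW, this]
    | add p q hp hq => simp only [map_add, hp, hq]
  refine ⟨homIdeal (annIdeal (linFun v)), ?_, ?_, ?_, _, finrank_ann_le k v hv, 2 * k + 1, ?_⟩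
  · intro G hG t
    rw [mem_homIdeal_of_homog (homogeneousComponent_isHomogeneous t G)]
    exact mem_homIdeal.1 hG t
  · intro G hG
    have h := hG none
    rw [homIdeal, Ideal.mem_comap] at h ⊢
    have h' := Ideal.mem_map_C_iff.1 h
    refine Ideal.mem_map_C_iff.2 fun n => ?_
    have h2 := h' (n + 1)
    have h3 : grDehom K σ (X none) = Polynomial.X := by simp [grDehom]
    change Polynomial.coeff (grDehom K σ (X none * G)) (n + 1) ∈ _ at h2
    rw [map_mul, h3, Polynomial.coeff_X_mul] at h2
    exact h2
  · intro G hG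
    refine diffOp_eq_zero _ _ fun l => ?_
    rw [hLl]
    have h := mem_homIdeal.1 (Ideal.mul_mem_left _ (monomial l 1) hG) (2 * k + 1)
    simpa using h 1
  · intro t ht
    refine quotDim_homIdeal _ (2 * k + 1) ?_ t ht
    intro a ha c
    refine mem_annIdeal_of _ _ fun b => ?_
    rw [monomial_mul, linFun_monomial, hv, mul_zero]
    rw [map_add]
    omega

/-- **tensor case, `s` odd.** Let `s = 2k + 1` be odd, `d_j = 1` and
`n_j = m` for all `j` (so `d = s`, `n = m·s`). For every nonzero multilinear
`f ∈ R_{(1,…,1)}` there is a saturated homogeneous ideal `I` of `S` contained in the apolar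
ideal `(u f)^⊥` with `dim_K (S/I)_t` equal to a constant `c ≤ 2·C(m·s + k, k)` for all
sufficiently large `t`; hence the cactus rank of `u f` w.r.t. the degree-`s` Veronese
embedding of `ℙ^{ms}` is at most `2·C(m·s + k, k)`. -/
theorem stmt11 (K : Type*) [Field K] [IsAlgClosed K] [CharZero K]
    (s : ℕ) (k : ℕ) (hs : s = 2 * k + 1) (m : ℕ) (hm : 0 < m)
    (f : MvPolynomial (RVar s (fun _ => m)) K)
    (hf : MultiHomog (fun _ => 1) f) (hf0 : f ≠ 0) :
    ∃ I : Ideal (MvPolynomial (SVar s (fun _ => m)) K),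
      IsHomogIdeal I ∧ IsSatIdeal I ∧
      (∀ g ∈ I, diffOp g (subst K s (fun _ => m) f) = 0) ∧
      ∃ c : ℕ,
        c ≤ 2 * Nat.choose (m * s + k) k ∧
        ∃ T : ℕ, ∀ t ≥ T, quotDim K I t = c := by
  have hf1 : f.IsHomogeneous s := by
    intro μ hμ
    have h := hf μ (mem_support_iff.2 hμ)
    rw [Pi.one_def, ← Finsupp.degree_eq_weight_one, Finsupp.degree_eq_sum, Fintype.sum_sigma]
    simp [h]
  have hF : (subst K s (fun _ => m) f).IsHomogeneous (2 * k + 1) := by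
    have := hf1.aeval (n := 1) (S := K) (fun v : RVar s (fun _ => m) =>
      if h : (v.2 : ℕ) = 0 then (X none : MvPolynomial (SVar s (fun _ => m)) K)
      else X (some ⟨v.1, ⟨(v.2 : ℕ) - 1, by have := v.2.isLt; omega⟩⟩)) (by
        intro v
        dsimp only
        split_ifs
        · exact isHomogeneous_X _ _
        · exact isHomogeneous_X _ _)
    rw [one_mul] at this
    rw [← hs]
    exact this
  have hc : Fintype.card (Σ _ : Fin s, Fin m) = m * s := by
    simp [mul_comm]
  have := main_general k _ hF
  rw [hc] at this
  exact this
end
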